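/- Let L = 1/(u_1·u_{1..2}), R = 1/(u_{1..2}·u_2) and M = 1/u_{1..2} = 1/(u_1+u_2) in Mould(2). Then: (i) M ∘_1 M = M ∘_2 M; (ii) M ∘_1 R = M ∘_2 L; (iii) M ∘_1 L = L ∘_2 M; (iv) R ∘_1 M = M ∘_2 R. (These identities, together with the dendriform relations for L and R, express that sending the graded Tridendriform generators to L, R and M defines a morphism of operads from grTriDend to Mould.) -/

import Mathlib

/-!
Formalization of results from "The anticyclic operad of moulds" (F. Chapoton).

`Mould n` is the field of rational functions in variables `u 1, …, u n` with
rational coefficients, realized as a subfield of the fraction field `K` of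
`ℚ[X 0, X 1, X 2, …]`.  The variable `u 0 = X 0` is reserved as an auxiliary
variable (the parameter `t` or `λ`).  Substitution of rational functions for
the variables is realized by the (partial, well-defined) function `msub`.
-/

noncomputable section
namespace MouldOperad

open MvPolynomial Finset

attribute [local instance] Classical.propDecidable
set_option synthInstance.maxHeartbeats 1000000

abbrev MPoly : Type := MvPolynomial ℕ ℚ
abbrev K : Type := FractionRing MPoly

/-- the variable `u i` (1-based; index `0` is auxiliary). -/
def u (i : ℕ) : K := algebraMap MPoly K (X i)

/-- `u_{i..j} = u_i + u_{i+1} + ⋯ + u_j`. -/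
def usum (i j : ℕ) : K := ∑ k ∈ Finset.Icc i j, u k

/-- evaluation of polynomials, sending the variable `X k` to `v k`. -/
def pev (v : ℕ → K) : MPoly →+* K :=
  eval₂Hom ((algebraMap MPoly K).comp (C : ℚ →+* MPoly)) v

/-- Substitution of the rational functions `v k` for the variables of `f ∈ K`
(the induced field homomorphism): it takes the canonical value whenever `f` has
a fraction representation whose denominator does not vanish under the
substitution (this value does not depend on the representation), and the junk
value `0` otherwise. -/
def msub (v : ℕ → K) (f : K) : K :=
  if h : ∃ w : K, ∃ p q : MPoly, q ≠ 0 ∧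
      f = algebraMap MPoly K p / algebraMap MPoly K q ∧
      pev v q ≠ 0 ∧ w = pev v p / pev v q
  then h.choose else 0

/-- the field `Mould n` of rational functions in `u 1, …, u n`. -/
def Mould (n : ℕ) : Subfield K :=
  Subfield.closure {x : K | ∃ i, 1 ≤ i ∧ i ≤ n ∧ x = u i}

/-- substitution used for `f` in `f ∘_i g`, where `g` has degree `n`:
`f(u_1, …, u_{i-1}, u_{i..i+n-1}, u_{i+n}, …, u_{m+n-1})`. -/
def compSubF (n i : ℕ) : ℕ → K := fun k =>
  if k < i then u k else if k = i then usum i (i + n - 1) else u (k + n - 1)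

/-- substitution used for `g` in `f ∘_i g` : `g(u_i, …, u_{i+n-1})`. -/
def compSubG (i : ℕ) : ℕ → K := fun k => u (k + i - 1)

/-- the composition `f ∘_i g`, where `g` has degree `n` (1-based index `i`). -/
def comp (n i : ℕ) (f g : K) : K :=
  usum i (i + n - 1) * msub (compSubF n i) f * msub (compSubG i) g

/-- the push `τ` on `Mould n`: `τ(f)(u_1,…,u_n) = f(-u_{1..n}, u_1, …, u_{n-1})`. -/
def push (n : ℕ) (f : K) : K :=
  msub (fun k => if k = 1 then -(usum 1 n) else if k ≤ n then u (k - 1) else u k) f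

/-- a permutation of `Fin n` as a (1-based) permutation of `ℕ`. -/
def permExt (n : ℕ) (σ : Equiv.Perm (Fin n)) : ℕ → ℕ := fun k =>
  if h : 1 ≤ k ∧ k ≤ n then ((σ ⟨k - 1, by omega⟩ : Fin n) : ℕ) + 1 else k

/-- `f ∈ Mould n` is alternal : for each `1 ≤ i ≤ n-1`, the sum of
`f(u_{σ(1)}, …, u_{σ(n)})` over the shuffles `σ ∈ Sh(i, n-i)` vanishes. -/
def IsAlternal (n : ℕ) (f : K) : Prop :=
  ∀ i : ℕ, 1 ≤ i → i ≤ n - 1 →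
    ∑ σ ∈ Finset.univ.filter (fun σ : Equiv.Perm (Fin n) =>
        (∀ a b : Fin n, a < b → (b : ℕ) < i → σ a < σ b) ∧
        (∀ a b : Fin n, a < b → i ≤ (a : ℕ) → σ a < σ b)),
      msub (fun k => u (permExt n σ k)) f = 0

/-- `f ∈ Mould n` is vegetal :
`u_1⋯u_n · Σ_{σ ∈ S_n} f(t·u_{σ(1)}, …, t·u_{σ(n)}) = n! · f(t,…,t)`,
where the auxiliary variable `t` is `u 0`. -/
def IsVegetal (n : ℕ) (f : K) : Prop :=
  (∏ k ∈ Finset.Icc 1 n, u k) *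
      ∑ σ : Equiv.Perm (Fin n), msub (fun k => u 0 * u (permExt n σ k)) f =
    (n.factorial : K) * msub (fun _ => u 0) f

/-- `f ∈ Mould n` is homogeneous of weight `d` : `f(λu_1,…,λu_n) = λ^d·f`,
where the auxiliary variable `λ` is `u 0`. -/
def IsHomogeneousOfWeight (n : ℕ) (d : ℤ) (f : K) : Prop :=
  msub (fun k => if 1 ≤ k ∧ k ≤ n then u 0 * u k else u k) f = u 0 ^ d * f

/-- shift substitution : `g(u_{m+1}, …, u_{m+n})`. -/
def shiftSub (m : ℕ) : ℕ → K := fun k => u (k + m)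

/-- `f ≻ g` for `f ∈ Mould m`, `g ∈ Mould n`. -/
def dsucc (m n : ℕ) (f g : K) : K :=
  f * msub (shiftSub m) g * usum (m + 1) (m + n) / usum 1 (m + n)

/-- `f ≺ g` for `f ∈ Mould m`, `g ∈ Mould n`. -/
def dprec (m n : ℕ) (f g : K) : K :=
  f * msub (shiftSub m) g * usum 1 m / usum 1 (m + n)

/-- `MU(f,g)` for `f ∈ Mould m`. -/
def MU (m : ℕ) (f g : K) : K := f * msub (shiftSub m) g

/-- `LIMU(f,g) = MU(f,g) - MU(g,f)` for `f ∈ Mould m`, `g ∈ Mould n`. -/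
def LIMU (m n : ℕ) (f g : K) : K := MU m f g - MU n g f

/-- the pre-Lie product `f ↶ g` for `f ∈ Mould m`, `g ∈ Mould n`. -/
def preLieCurve (m n : ℕ) (f g : K) : K :=
  f * msub (shiftSub m) g * usum (m + 1) (m + n) / usum 1 (m + n)
    - g * msub (shiftSub n) f * usum 1 n / usum 1 (m + n)

/-- the pre-Lie product `f ∘ g = Σ_{i=1}^m f ∘_i g`, `f ∈ Mould m`, `g ∈ Mould n`. -/
def preLieComp (m n : ℕ) (f g : K) : K := ∑ i ∈ Finset.Icc 1 m, comp n i f g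

/-- `H_n = ∏_{1 ≤ i ≤ j ≤ n} u_{i..j}`. -/
def Hprod (n : ℕ) : K := ∏ i ∈ Finset.Icc 1 n, ∏ j ∈ Finset.Icc i n, usum i j

/-- `x` is (the image of) a polynomial in `u_1, …, u_n`. -/
def IsPolyIn (n : ℕ) (x : K) : Prop :=
  ∃ p : MPoly, (∀ k ∈ p.vars, 1 ≤ k ∧ k ≤ n) ∧ x = algebraMap MPoly K p

/-- `f ∈ Mould n` has nice poles: it is a polynomial divided by a product of
powers of the linear forms `u_{i..j}`, `1 ≤ i ≤ j ≤ n`. -/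
def HasNicePoles (n : ℕ) (f : K) : Prop :=
  ∃ (P : MPoly) (e : ℕ → ℕ → ℕ),
    (∀ k ∈ P.vars, 1 ≤ k ∧ k ≤ n) ∧
    f = algebraMap MPoly K P /
        ∏ i ∈ Finset.Icc 1 n, ∏ j ∈ Finset.Icc i n, usum i j ^ e i j

/-- the Over product `f / Y`, `f ∈ Mould n`. -/
def overY (n : ℕ) (f : K) : K := f / usum 1 (n + 1)

/-- the Under product `Y \ f`, `f ∈ Mould n`. -/
def underY (n : ℕ) (f : K) : K := msub (fun k => u (k + 1)) f / usum 1 (n + 1)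

/-- `ARIT(f,g) = f ∘ (g/Y) - f ∘ (Y\g)` for `f ∈ Mould m`, `g ∈ Mould n`. -/
def ARIT (m n : ℕ) (f g : K) : K :=
  preLieComp m (n + 1) f (overY n g) - preLieComp m (n + 1) f (underY n g)

/-- `ARI(f,g) = ARIT(f,g) - ARIT(g,f) + LIMU(f,g)`, `f ∈ Mould m`, `g ∈ Mould n`. -/
def ARI (m n : ℕ) (f g : K) : K := ARIT m n f g - ARIT n m g f + LIMU m n f g

/-- evaluation of polynomials into `RatFunc K` (rational functions in `t` over `K`). -/
def pevR (v : ℕ → RatFunc K) : MPoly →+* RatFunc K :=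
  eval₂Hom ((RatFunc.C).comp ((algebraMap MPoly K).comp (C : ℚ →+* MPoly))) v

/-- substitution into `RatFunc K`. -/
def msubR (v : ℕ → RatFunc K) (f : K) : RatFunc K :=
  if h : ∃ w : RatFunc K, ∃ p q : MPoly, q ≠ 0 ∧
      f = algebraMap MPoly K p / algebraMap MPoly K q ∧
      pevR v q ≠ 0 ∧ w = pevR v p / pevR v q
  then h.choose else 0

/-- residue at `t = 0`: the coefficient of `t⁻¹` in the Laurent expansion at `0`. -/
def res (r : RatFunc K) : K := (↑r : LaurentSeries K).coeff (-1)

/-- the mould derivative `∂f` for `f ∈ Mould m`: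
`∂f(u_1,…,u_{m-1}) = Σ_{j=1}^m Res_{t=0} f(u_1,…,u_{j-1},t,u_j,…,u_{m-1})`,
where `f(u_1,…,u_{j-1},t,u_j,…,u_{m-1})` is viewed in `RatFunc K`. -/
def mderiv (m : ℕ) (f : K) : K :=
  ∑ j ∈ Finset.Icc 1 m,
    res (msubR (fun k =>
      if k < j then RatFunc.C (u k)
      else if k = j then RatFunc.X
      else RatFunc.C (u (k - 1))) f)

/-- evaluation of polynomials into `ℚ(x)`, sending every variable to `1/x`. -/
def pevX : MPoly →+* RatFunc ℚ :=
  eval₂Hom (RatFunc.C : ℚ →+* RatFunc ℚ) (fun _ => (RatFunc.X)⁻¹)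

/-- the substitution `u_i ↦ 1/x`, landing in `ℚ(x)`. -/
def evalx (f : K) : RatFunc ℚ :=
  if h : ∃ w : RatFunc ℚ, ∃ p q : MPoly, q ≠ 0 ∧
      f = algebraMap MPoly K p / algebraMap MPoly K q ∧
      pevX q ≠ 0 ∧ w = pevX p / pevX q
  then h.choose else 0

/-- the derivative `d/dx` on `ℚ(x)`. -/
def rfDeriv (r : RatFunc ℚ) : RatFunc ℚ :=
  (algebraMap (Polynomial ℚ) (RatFunc ℚ) (Polynomial.derivative r.num) *
      algebraMap (Polynomial ℚ) (RatFunc ℚ) r.denom -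
    algebraMap (Polynomial ℚ) (RatFunc ℚ) r.num *
      algebraMap (Polynomial ℚ) (RatFunc ℚ) (Polynomial.derivative r.denom)) /
    algebraMap (Polynomial ℚ) (RatFunc ℚ) r.denom ^ 2
/-- Substitution into an explicit fraction takes its canonical value. -/
theorem msub_div (v : ℕ → K) (p q : MPoly) (hq : pev v q ≠ 0) :
    msub v (algebraMap MPoly K p / algebraMap MPoly K q) = pev v p / pev v q := by
  have hinj : Function.Injective (algebraMap MPoly K) := IsFractionRing.injective MPoly K
  have ne_zero : ∀ r : MPoly, pev v r ≠ 0 → r ≠ 0 := by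
    rintro r hr rfl
    exact hr (map_zero _)
  have h : ∃ w : K, ∃ p' q' : MPoly, q' ≠ 0 ∧
      algebraMap MPoly K p / algebraMap MPoly K q =
        algebraMap MPoly K p' / algebraMap MPoly K q' ∧
      pev v q' ≠ 0 ∧ w = pev v p' / pev v q' :=
    ⟨_, p, q, ne_zero q hq, rfl, hq, rfl⟩
  rw [msub, dif_pos h]
  obtain ⟨p', q', hq'0, hfrac, hq', hw⟩ := h.choose_spec
  rw [hw]
  have hne : ∀ r : MPoly, r ≠ 0 → algebraMap MPoly K r ≠ 0 := fun r hr =>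
    (map_ne_zero_iff _ hinj).2 hr
  rw [div_eq_div_iff (hne q (ne_zero q hq)) (hne q' hq'0), ← map_mul, ← map_mul] at hfrac
  rw [div_eq_div_iff hq' hq, ← map_mul, ← map_mul, hinj hfrac]

theorem msub_inv (v : ℕ → K) (q : MPoly) (hq : pev v q ≠ 0) :
    msub v (algebraMap MPoly K q)⁻¹ = (pev v q)⁻¹ := by
  simpa using msub_div v 1 q hq

@[simp]
theorem pev_X (v : ℕ → K) (i : ℕ) : pev v (X i) = v i := by
  simp [pev]

theorem usum_eq_algebraMap (i j : ℕ) :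
    usum i j = algebraMap MPoly K (∑ k ∈ Finset.Icc i j, X k) := by
  simp [usum, u]

theorem usum_ne_zero {i j : ℕ} (h : i ≤ j) : usum i j ≠ 0 := by
  rw [usum_eq_algebraMap, map_ne_zero_iff _ (IsFractionRing.injective MPoly K)]
  intro h0
  have h1 := congrArg (MvPolynomial.eval (fun _ => (1 : ℚ))) h0
  simp only [map_sum, eval_X, map_zero, sum_const, Nat.card_Icc, nsmul_eq_mul, mul_one,
    Nat.cast_eq_zero] at h1
  omega

theorem usum_self (i : ℕ) : usum i i = u i := by
  simp [usum]

theorem usum_succ {i j : ℕ} (h : i ≤ j + 1) : usum i (j + 1) = usum i j + u (j + 1) :=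
  Finset.sum_Icc_succ_top h _

theorem u_ne_zero (i : ℕ) : u i ≠ 0 :=
  usum_self i ▸ usum_ne_zero le_rfl

theorem usum_one_two : usum 1 2 = u 1 + u 2 := by
  rw [usum_succ (by omega), usum_self]

theorem usum_two_three : usum 2 3 = u 2 + u 3 := by
  rw [usum_succ (by omega), usum_self]

theorem usum_one_three : usum 1 3 = u 1 + u 2 + u 3 := by
  rw [usum_succ (by omega), usum_one_two]

theorem msub_inv_usum (v : ℕ → K) (h : v 1 + v 2 ≠ 0) :
    msub v (usum 1 2)⁻¹ = (v 1 + v 2)⁻¹ := by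
  have := msub_inv v (X 1 + X 2) (by simpa using h)
  simpa [usum_one_two, u] using this

theorem msub_inv_u_mul_usum (v : ℕ → K) (h1 : v 1 ≠ 0) (h : v 1 + v 2 ≠ 0) :
    msub v (u 1 * usum 1 2)⁻¹ = (v 1 * (v 1 + v 2))⁻¹ := by
  have := msub_inv v (X 1 * (X 1 + X 2)) (by simpa using ⟨h1, h⟩)
  rwa [map_mul, map_mul, map_add, map_add, pev_X, pev_X, ← u, ← u, ← usum_one_two] at this

theorem msub_inv_usum_mul_u (v : ℕ → K) (h2 : v 2 ≠ 0) (h : v 1 + v 2 ≠ 0) :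
    msub v (usum 1 2 * u 2)⁻¹ = ((v 1 + v 2) * v 2)⁻¹ := by
  have := msub_inv v ((X 1 + X 2) * X 2) (by simpa using ⟨h, h2⟩)
  rwa [map_mul, map_mul, map_add, map_add, pev_X, pev_X, ← u, ← u, ← usum_one_two] at this

/-- with `L = 1/(u_1·u_{1..2})`, `R = 1/(u_{1..2}·u_2)` and
`M = 1/(u_1+u_2)` in `Mould 2`, one has `M ∘_1 M = M ∘_2 M`,
`M ∘_1 R = M ∘_2 L`, `M ∘_1 L = L ∘_2 M`, `R ∘_1 M = M ∘_2 R`. -/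
theorem tridendriform_relations (L R M : K)
    (hL : L = (u 1 * usum 1 2)⁻¹) (hR : R = (usum 1 2 * u 2)⁻¹)
    (hM : M = (usum 1 2)⁻¹) :
    comp 2 1 M M = comp 2 2 M M ∧
    comp 2 1 M R = comp 2 2 M L ∧
    comp 2 1 M L = comp 2 2 L M ∧
    comp 2 1 R M = comp 2 2 M R := by
  subst hL hR hM
  have h1 := u_ne_zero 1
  have h2 := u_ne_zero 2
  have h3 := u_ne_zero 3
  have h12 : u 1 + u 2 ≠ 0 := usum_one_two ▸ usum_ne_zero (by omega)
  have h23 : u 2 + u 3 ≠ 0 := usum_two_three ▸ usum_ne_zero (by omega)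
  have h123 : u 1 + u 2 + u 3 ≠ 0 := usum_one_three ▸ usum_ne_zero (by omega)
  have f11 : compSubF 2 1 1 = u 1 + u 2 := by simp [compSubF, usum_one_two]
  have f12 : compSubF 2 1 2 = u 3 := by simp [compSubF]
  have f21 : compSubF 2 2 1 = u 1 := by simp [compSubF]
  have f22 : compSubF 2 2 2 = u 2 + u 3 := by simp [compSubF, usum_two_three]
  have g11 : compSubG 1 1 = u 1 := rfl
  have g12 : compSubG 1 2 = u 2 := rfl
  have g21 : compSubG 2 1 = u 2 := rfl
  have g22 : compSubG 2 2 = u 3 := rfl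
  have s1 : usum 1 (1 + 2 - 1) = u 1 + u 2 := usum_one_two
  have s2 : usum 2 (2 + 2 - 1) = u 2 + u 3 := usum_two_three
  have F1M := msub_inv_usum (compSubF 2 1) (by rwa [f11, f12])
  have F2M := msub_inv_usum (compSubF 2 2) (by rwa [f21, f22, ← add_assoc])
  have F2L := msub_inv_u_mul_usum (compSubF 2 2) (by rwa [f21]) (by rwa [f21, f22, ← add_assoc])
  have F1R := msub_inv_usum_mul_u (compSubF 2 1) (by rwa [f12]) (by rwa [f11, f12])
  have G1M := msub_inv_usum (compSubG 1) (by rwa [g11, g12])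
  have G2M := msub_inv_usum (compSubG 2) (by rwa [g21, g22])
  have G1L := msub_inv_u_mul_usum (compSubG 1) (by rwa [g11]) (by rwa [g11, g12])
  have G2L := msub_inv_u_mul_usum (compSubG 2) (by rwa [g21]) (by rwa [g21, g22])
  have G1R := msub_inv_usum_mul_u (compSubG 1) (by rwa [g12]) (by rwa [g11, g12])
  have G2R := msub_inv_usum_mul_u (compSubG 2) (by rwa [g22]) (by rwa [g21, g22])
  simp only [comp, F1M, F2M, F2L, F1R, G1M, G2M, G1L, G2L, G1R, G2R,
    f11, f12, f21, f22, g11, g12, g21, g22]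
  simp only [s1, s2, ← add_assoc]
  refine ⟨?_, ?_, ?_, ?_⟩ <;> field_simp

end MouldOperad
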